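/- arXiv:math/0209201 — 2 statements merged into one kernel-verified Lean document; each statement's English description precedes it below -/
import Mathlib

section
/- In the SVD frame setting, let ω be any alternating (n−2)-form on V₁, regarded as a form on V via the projection V → V₁. Then the n-form Ω₁ − Ω₂ ∧ ω evaluated on the orthonormal frame of the graph of p satisfies (Ω₁ − Ω₂ ∧ ω)(e₁, e₂, …, e_n) = (1 − λ₁ λ₂ · ω(a₃, …, a_n)) / √((1+λ₁²)(1+λ₂²)). -/
noncomputable section

variable {V₁ V₂ : Type*} [NormedAddCommGroup V₁] [InnerProductSpace ℝ V₁]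
  [NormedAddCommGroup V₂] [InnerProductSpace ℝ V₂]

/-- The canonical inclusion of a pair into the `L²` product `V = V₁ × V₂`. -/
def toProd (x : V₁) (y : V₂) : WithLp 2 (V₁ × V₂) :=
  (WithLp.equiv 2 (V₁ × V₂)).symm (x, y)

/-- Projection `V = V₁ × V₂ → V₁`. -/
def proj₁ : WithLp 2 (V₁ × V₂) →ₗ[ℝ] V₁ :=
  (LinearMap.fst ℝ V₁ V₂).comp (WithLp.linearEquiv 2 ℝ (V₁ × V₂)).toLinearMap

/-- Projection `V = V₁ × V₂ → V₂`. -/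
def proj₂ : WithLp 2 (V₁ × V₂) →ₗ[ℝ] V₂ :=
  (LinearMap.snd ℝ V₁ V₂).comp (WithLp.linearEquiv 2 ℝ (V₁ × V₂)).toLinearMap

/-- The wedge product of a real-valued alternating `2`-form and `m`-form, an
alternating `(m+2)`-form (the sum over shuffles, i.e. the determinant convention). -/
def wedge {V : Type*} [AddCommGroup V] [Module ℝ V] {m : ℕ}
    (Ω : V [⋀^Fin 2]→ₗ[ℝ] ℝ) (ω : V [⋀^Fin m]→ₗ[ℝ] ℝ) : V [⋀^Fin (m + 2)]→ₗ[ℝ] ℝ :=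
  ((TensorProduct.lid ℝ ℝ).toLinearMap.compAlternatingMap
    (Ω.domCoprod ω)).domDomCongr (finSumFinEquiv.trans (finCongr (Nat.add_comm 2 m)))

theorem AlternatingMap.domCoprod_apply_of_forall_eq_zero {V : Type*} [AddCommGroup V]
    [Module ℝ V] {ι κ : Type*} [Fintype ι] [Fintype κ] [DecidableEq ι] [DecidableEq κ]
    (f : V [⋀^ι]→ₗ[ℝ] ℝ) (g : V [⋀^κ]→ₗ[ℝ] ℝ) (w : ι ⊕ κ → V)
    (hw : ∀ (v : ι → V) (i : ι) (k : κ), v i = w (Sum.inr k) → f v = 0) :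
    f.domCoprod g w = f (fun i => w (Sum.inl i)) ⊗ₜ[ℝ] g (fun k => w (Sum.inr k)) := by
  rw [AlternatingMap.domCoprod_apply, sum_apply,
    Finset.sum_eq_single (QuotientGroup.mk (1 : Equiv.Perm (ι ⊕ κ)))]
  · simp [AlternatingMap.domCoprod.summand]
  · intro σ _ hσ
    induction σ using Quotient.inductionOn' with | h σ => ?_
    rw [AlternatingMap.domCoprod.summand_mk'']
    suffices h : f (fun i => w (σ (Sum.inl i))) = 0 by
      simp [MultilinearMap.domDomCongr_apply, h]
    by_cases hmaps : Set.MapsTo σ (Set.range Sum.inl) (Set.range Sum.inl)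
    · refine absurd (QuotientGroup.eq.mpr ?_).symm hσ
      simpa using Equiv.Perm.mem_sumCongrHom_range_of_perm_mapsTo_inl hmaps
    · simp only [Set.MapsTo, Set.forall_mem_range, not_forall] at hmaps
      obtain ⟨i, hi⟩ := hmaps
      cases hk : σ (Sum.inl i) with
      | inl j => exact absurd ⟨j, hk.symm⟩ hi
      | inr k => exact hw _ i k (congrArg w hk)
  · simp

theorem wedge_apply_of_forall_eq_zero {V : Type*} [AddCommGroup V] [Module ℝ V] {m : ℕ}
    (Ω : V [⋀^Fin 2]→ₗ[ℝ] ℝ) (ω : V [⋀^Fin m]→ₗ[ℝ] ℝ) (e : Fin (m + 2) → V)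
    (he : ∀ (v : Fin 2 → V) (i : Fin 2) (k : Fin m), v i = e k.succ.succ → Ω v = 0) :
    wedge Ω ω e = Ω ![e 0, e 1] * ω (fun k => e k.succ.succ) := by
  have hr (k : Fin m) : (finSumFinEquiv.trans (finCongr (Nat.add_comm 2 m))) (Sum.inr k) =
      k.succ.succ := by
    ext; simp
  rw [wedge, AlternatingMap.domDomCongr_apply, LinearMap.compAlternatingMap_apply,
    AlternatingMap.domCoprod_apply_of_forall_eq_zero]
  · simp only [Function.comp_apply, hr, LinearEquiv.coe_coe, TensorProduct.lid_tmul, smul_eq_mul]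
    congr 2
    ext i
    fin_cases i <;> rfl
  · intro v i k h
    exact he v i k (by simpa only [Function.comp_apply, hr] using h)

@[simp]
theorem proj₁_toProd (x : V₁) (y : V₂) : proj₁ (toProd x y) = x := rfl

@[simp]
theorem proj₂_toProd (x : V₁) (y : V₂) : proj₂ (toProd x y) = y := rfl

/-- In the SVD frame setting, for any alternating `(n−2)`-form `ω` on `V₁`,
`(Ω₁ − Ω₂ ∧ ω)(e₁, …, e_n) = (1 − λ₁ λ₂ ω(a₃, …, a_n)) / √((1+λ₁²)(1+λ₂²))`. -/
theorem omega_eval_on_graph_frame (m : ℕ)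
    (a : OrthonormalBasis (Fin (m + 2)) ℝ V₁) (b : OrthonormalBasis (Fin 2) ℝ V₂)
    (l₁ l₂ : ℝ) (ω : V₁ [⋀^Fin m]→ₗ[ℝ] ℝ)
    (e : Fin (m + 2) → WithLp 2 (V₁ × V₂))
    (he₀ : e ⟨0, by omega⟩ =
      (Real.sqrt (1 + l₁ ^ 2))⁻¹ • toProd (a ⟨0, by omega⟩) (l₁ • b 0))
    (he₁ : e ⟨1, by omega⟩ =
      (Real.sqrt (1 + l₂ ^ 2))⁻¹ • toProd (a ⟨1, by omega⟩) (l₂ • b 1))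
    (he : ∀ i : Fin (m + 2), 2 ≤ (i : ℕ) → e i = toProd (a i) 0) :
    ((a.toBasis.det.compLinearMap proj₁ :
        WithLp 2 (V₁ × V₂) [⋀^Fin (m + 2)]→ₗ[ℝ] ℝ) -
      wedge (b.toBasis.det.compLinearMap proj₂) (ω.compLinearMap proj₁)) e =
    (1 - l₁ * l₂ * ω (fun i : Fin m => a ⟨(i : ℕ) + 2, by omega⟩)) /
      Real.sqrt ((1 + l₁ ^ 2) * (1 + l₂ ^ 2)) := by
  have h₀ : e 0 = (Real.sqrt (1 + l₁ ^ 2))⁻¹ • toProd (a 0) (l₁ • b 0) := he₀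
  have h₁ : e 1 = (Real.sqrt (1 + l₂ ^ 2))⁻¹ • toProd (a 1) (l₂ • b 1) := he₁
  have hs (k : Fin m) : e k.succ.succ = toProd (a k.succ.succ) 0 := he _ (by simp)
  have hdet : a.toBasis.det (fun i => proj₁ (e i)) =
      (Real.sqrt (1 + l₁ ^ 2))⁻¹ * (Real.sqrt (1 + l₂ ^ 2))⁻¹ := by
    have hsmul : (fun i => proj₁ (e i)) = fun i => (Fin.cons (Real.sqrt (1 + l₁ ^ 2))⁻¹
        (Fin.cons (Real.sqrt (1 + l₂ ^ 2))⁻¹ fun _ => 1) : Fin (m + 2) → ℝ) i • a.toBasis i := by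
      funext i
      refine Fin.cases ?_ (Fin.cases ?_ fun k => ?_) i
      · simp [h₀]
      · simp [h₁]
      · simp [hs]
    rw [hsmul]
    refine (a.toBasis.det.toMultilinearMap.map_smul_univ _ _).trans ?_
    rw [AlternatingMap.coe_multilinearMap, Module.Basis.det_self]
    simp [Fin.prod_univ_succ]
  have hdet₂ : b.toBasis.det ![proj₂ (e 0), proj₂ (e 1)] =
      (Real.sqrt (1 + l₁ ^ 2))⁻¹ * l₁ * ((Real.sqrt (1 + l₂ ^ 2))⁻¹ * l₂) := by
    simp [h₀, h₁, Module.Basis.det_apply, Matrix.det_fin_two, Module.Basis.toMatrix_apply]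
  have hcomp : ⇑(proj₂ : WithLp 2 (V₁ × V₂) →ₗ[ℝ] V₂) ∘ ![e 0, e 1] =
      ![proj₂ (e 0), proj₂ (e 1)] := by
    ext i; fin_cases i <;> rfl
  rw [AlternatingMap.sub_apply, wedge_apply_of_forall_eq_zero]
  · have hω : (ω.compLinearMap proj₁) (fun k => e k.succ.succ) =
        ω (fun i : Fin m => a ⟨(i : ℕ) + 2, by omega⟩) := by
      simp only [AlternatingMap.compLinearMap_apply, hs, proj₁_toProd]
      rfl
    rw [hω, AlternatingMap.compLinearMap_apply, AlternatingMap.compLinearMap_apply]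
    simp only [Function.comp_def] at hcomp
    simp only [hcomp, hdet, hdet₂]
    rw [Real.sqrt_mul (by positivity), div_eq_mul_inv, mul_inv]
    ring
  · intro v i k h
    rw [AlternatingMap.compLinearMap_apply]
    exact AlternatingMap.map_coord_zero _ i (by simp [h, hs])

end
end

section
/- Let n ≥ 2, let δ ∈ [0, 1], let λ₁, λ₂ be real numbers with |λ₁ λ₂| ≤ 1 − δ, and let h : {1, 2} × {1, …, n} × {1, …, n} → ℝ be any array of real numbers. Then Σ_{α=1}^{2} Σ_{i=1}^{n} Σ_{k=1}^{n} h_{αik}² − 2 λ₁ λ₂ Σ_{k=1}^{n} (h_{1,1,k} h_{2,2,k} − h_{1,2,k} h_{2,1,k}) ≥ δ Σ_{α=1}^{2} Σ_{i=1}^{n} Σ_{k=1}^{n} h_{αik}². -/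
/-- Twice a sum of `2 × 2` minors is bounded by the sum of squares of all entries. -/
theorem two_mul_abs_sum_minors_le {ι κ : Type*} [Fintype ι] [Fintype κ] {i j : ι} (hij : i ≠ j)
    (h : Fin 2 → ι → κ → ℝ) :
    2 * |∑ k, (h 0 i k * h 1 j k - h 0 j k * h 1 i k)| ≤ ∑ α, ∑ i, ∑ k, h α i k ^ 2 := by
  classical
  have hpair (α : Fin 2) :
      ∑ k, h α i k ^ 2 + ∑ k, h α j k ^ 2 ≤ ∑ i, ∑ k, h α i k ^ 2 := by
    rw [← Finset.sum_pair (f := fun i => ∑ k, h α i k ^ 2) hij]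
    exact Finset.sum_le_sum_of_subset_of_nonneg (Finset.subset_univ _)
      fun _ _ _ => Finset.sum_nonneg fun _ _ => sq_nonneg _
  have hterm (k : κ) : 2 * |h 0 i k * h 1 j k - h 0 j k * h 1 i k| ≤
      h 0 i k ^ 2 + h 0 j k ^ 2 + (h 1 i k ^ 2 + h 1 j k ^ 2) := by
    rw [← le_div_iff₀' two_pos, abs_le]
    constructor
    · linarith [sq_nonneg (h 0 i k + h 1 j k), sq_nonneg (h 0 j k - h 1 i k)]
    · linarith [sq_nonneg (h 0 i k - h 1 j k), sq_nonneg (h 0 j k + h 1 i k)]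
  calc 2 * |∑ k, (h 0 i k * h 1 j k - h 0 j k * h 1 i k)|
      ≤ 2 * ∑ k, |h 0 i k * h 1 j k - h 0 j k * h 1 i k| := by
        gcongr
        exact Finset.abs_sum_le_sum_abs _ _
    _ ≤ ∑ k, (h 0 i k ^ 2 + h 0 j k ^ 2 + (h 1 i k ^ 2 + h 1 j k ^ 2)) := by
        rw [Finset.mul_sum]
        exact Finset.sum_le_sum fun k _ => hterm k
    _ ≤ ∑ α, ∑ i, ∑ k, h α i k ^ 2 := by
        simp only [Finset.sum_add_distrib, Fin.sum_univ_two]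
        exact add_le_add (hpair 0) (hpair 1)


open Finset in
/-- If `|λ₁ λ₂| ≤ 1 - δ`, the zeroth-order term in the evolution equation of `*Ω₁`
dominates `δ |A|²`. -/
theorem quadratic_term_bound (n : ℕ) (hn : 2 ≤ n) (δ : ℝ) (hδ0 : 0 ≤ δ) (hδ1 : δ ≤ 1)
    (l₁ l₂ : ℝ) (hl : |l₁ * l₂| ≤ 1 - δ) (h : Fin 2 → Fin n → Fin n → ℝ) :
    (∑ α : Fin 2, ∑ i : Fin n, ∑ k : Fin n, h α i k ^ 2) -
      2 * (l₁ * l₂) * ∑ k : Fin n,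
        (h 0 ⟨0, by omega⟩ k * h 1 ⟨1, by omega⟩ k -
          h 0 ⟨1, by omega⟩ k * h 1 ⟨0, by omega⟩ k) ≥
    δ * ∑ α : Fin 2, ∑ i : Fin n, ∑ k : Fin n, h α i k ^ 2 := by
  have hminors := two_mul_abs_sum_minors_le
    (i := (⟨0, by omega⟩ : Fin n)) (j := ⟨1, by omega⟩) (by simp) h
  set S := ∑ α : Fin 2, ∑ i : Fin n, ∑ k : Fin n, h α i k ^ 2
  set Q := ∑ k : Fin n, (h 0 ⟨0, by omega⟩ k * h 1 ⟨1, by omega⟩ k -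
    h 0 ⟨1, by omega⟩ k * h 1 ⟨0, by omega⟩ k)
  have hbound : |l₁ * l₂| * (2 * |Q|) ≤ (1 - δ) * S :=
    mul_le_mul hl hminors (by positivity) (by linarith)
  have habs : l₁ * l₂ * Q ≤ |l₁ * l₂| * |Q| := by
    rw [← abs_mul]
    exact le_abs_self _
  linarith
end
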